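/- Assume R(0) = 0, R(1) = 1, that no c_i lies in {0,1}, and that no d_i lies in {0,1}. Let a ∈ ℂ \ {0,1} with q(a) ≠ 0, R'(a) ≠ 0 and R(a) ∉ {0,1}. Then for every z ∈ ℂ that is not a critical value of R and with z ∉ {0, 1, R(a), d_1, …, d_{2d−2}}, one has Σ_{y ∈ ℂ, R(y)=z} γ_a(y)/(R'(y))² = γ_{R(a)}(z)/R'(a) + Σ_{i=1}^{2d−2} b_i · γ_a(c_i) · γ_{d_i}(z). -/

import Mathlib

open MeasureTheory Polynomial Filter Topology

noncomputable section

/-- The rational map `R = p/q` as a function on `ℂ`. -/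
def Rfun (p q : Polynomial ℂ) : ℂ → ℂ := fun z => p.eval z / q.eval z

/-- `z ∈ ℂ` is a critical value of `R = p/q`. -/
def IsCritValue (p q : Polynomial ℂ) (z : ℂ) : Prop :=
  ∃ c : ℂ, q.eval c ≠ 0 ∧ deriv (Rfun p q) c = 0 ∧ Rfun p q c = z

/-- The Ruelle (transfer) operator: `(R*φ)(z) = ∑_{R(y) = z} φ(y)/(R'(y))²`,
the sum being over the fiber of `R = p/q` over `z`. -/
def ruelleOp (p q : Polynomial ℂ) (φ : ℂ → ℂ) : ℂ → ℂ := fun z =>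
  ∑' y : {y : ℂ // q.eval y ≠ 0 ∧ Rfun p q y = z},
    φ (y : ℂ) / (deriv (Rfun p q) (y : ℂ)) ^ 2

/-- `(Rⁿ)'(a) = ∏_{j<n} R'(Rʲ(a))`. -/
def derivIter (p q : Polynomial ℂ) (n : ℕ) (a : ℂ) : ℂ :=
  ∏ j ∈ Finset.range n, deriv (Rfun p q) ((Rfun p q)^[j] a)

/-- `γ_a(z) = a(a-1)/(z(z-1)(z-a))`. -/
def gam (a z : ℂ) : ℂ := a * (a - 1) / (z * (z - 1) * (z - a))


/-- Partial fractions: the residues of `N / D` sum to zero if `D` has simple roots and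
`N / D` vanishes to order at least two at infinity. -/
lemma sum_eval_div_derivative_eq_zero {K : Type*} [Field K] [IsAlgClosed K] [DecidableEq K]
    {N D : K[X]} (hdeg : N.natDegree + 2 ≤ D.natDegree)
    (hsimple : ∀ r, D.eval r = 0 → D.derivative.eval r ≠ 0) :
    ∑ r ∈ D.roots.toFinset, N.eval r / D.derivative.eval r = 0 := by
  have hD : D ≠ 0 := by
    rintro rfl
    simp at hdeg
  have hnodup : D.roots.Nodup := by
    rw [Multiset.nodup_iff_count_le_one]
    intro r
    rw [count_roots]
    by_contra! h
    obtain ⟨h0, h1⟩ := (one_lt_rootMultiplicity_iff_isRoot hD).1 h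
    exact hsimple r h0 h1
  have hsplit : D.Splits := IsAlgClosed.splits D
  have hcard : D.roots.toFinset.card = D.natDegree := by
    rw [Multiset.toFinset_card_of_nodup hnodup, hsplit.natDegree_eq_card_roots]
  have hfac : D = C D.leadingCoeff * Lagrange.nodal D.roots.toFinset id := by
    conv_lhs => rw [hsplit.eq_prod_roots]
    rw [Lagrange.nodal, Finset.prod_eq_multiset_prod, Multiset.toFinset_val, hnodup.dedup]
    simp
  have hder : ∀ r ∈ D.roots.toFinset,
      D.derivative.eval r = D.leadingCoeff * ∏ j ∈ D.roots.toFinset.erase r, (r - j) := by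
    intro r hr
    have := Lagrange.eval_nodal_derivative_eval_node_eq (v := id) hr
    simp only [id, Lagrange.eval_nodal] at this
    conv_lhs => rw [hfac]
    rw [derivative_C_mul, eval_C_mul, this]
  have hlag := Lagrange.coeff_eq_sum (s := D.roots.toFinset) (v := id) (P := N)
    (Function.injective_id.injOn) (by
      rw [hcard]
      exact degree_le_natDegree.trans_lt (by exact_mod_cast (by omega)))
  rw [hcard, coeff_eq_zero_of_natDegree_lt (by omega)] at hlag
  calc ∑ r ∈ D.roots.toFinset, N.eval r / D.derivative.eval r
      = ∑ r ∈ D.roots.toFinset, D.leadingCoeff⁻¹ *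
          (N.eval r / ∏ j ∈ D.roots.toFinset.erase r, (r - j)) := by
        refine Finset.sum_congr rfl fun r hr => ?_
        rw [hder r hr, div_mul_eq_div_div_swap, div_eq_mul_inv _ D.leadingCoeff, mul_comm]
    _ = 0 := by
        rw [← Finset.mul_sum]
        simp only [id] at hlag
        rw [← hlag, mul_zero]

/-- The numerator `p' q - p q'` of the derivative of `p / q`. -/
def derivNum (p q : ℂ[X]) : ℂ[X] := derivative p * q - p * derivative q

lemma eval_derivNum (p q : ℂ[X]) (x : ℂ) :
    (derivNum p q).eval x =
      p.derivative.eval x * q.eval x - p.eval x * q.derivative.eval x := by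
  simp [derivNum]

lemma natDegree_derivNum_le (p q : ℂ[X]) (hp : 0 < p.natDegree) (hq : 0 < q.natDegree) :
    (derivNum p q).natDegree ≤ p.natDegree + q.natDegree - 1 := by
  have h1 := natDegree_derivative_le p
  have h2 := natDegree_derivative_le q
  refine (natDegree_sub_le _ _).trans (max_le ?_ ?_)
  · exact natDegree_mul_le.trans (by omega)
  · exact natDegree_mul_le.trans (by omega)

lemma deriv_Rfun (p q : ℂ[X]) {x : ℂ} (hx : q.eval x ≠ 0) :
    deriv (Rfun p q) x = (derivNum p q).eval x / q.eval x ^ 2 := by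
  rw [eval_derivNum]
  exact ((p.hasDerivAt x).div (q.hasDerivAt x) hx).deriv

lemma derivNum_eval_eq_zero_iff (p q : ℂ[X]) {x : ℂ} (hx : q.eval x ≠ 0) :
    (derivNum p q).eval x = 0 ↔ deriv (Rfun p q) x = 0 := by
  rw [deriv_Rfun p q hx, div_eq_zero_iff]
  simp [hx]

lemma deriv_deriv_Rfun (p q : ℂ[X]) {x : ℂ} (hx : q.eval x ≠ 0)
    (hcrit : deriv (Rfun p q) x = 0) :
    deriv (deriv (Rfun p q)) x = (derivNum p q).derivative.eval x / q.eval x ^ 2 := by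
  have hev : deriv (Rfun p q) =ᶠ[𝓝 x] fun y => (derivNum p q).eval y / q.eval y ^ 2 := by
    filter_upwards [q.continuous.continuousAt.eventually_ne hx] with y hy
    exact deriv_Rfun p q hy
  rw [hev.deriv_eq,
    (((derivNum p q).hasDerivAt x).fun_div ((q.hasDerivAt x).fun_pow 2) (pow_ne_zero 2 hx)).deriv,
    (derivNum_eval_eq_zero_iff p q hx).2 hcrit]
  field_simp
  ring

theorem ruelle_of_gamma (d : ℕ) (hd : 2 ≤ d) (p q : Polynomial ℂ) (hcop : IsCoprime p q)
    (hdp : p.natDegree = d) (hdq : q.natDegree = d - 1)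
    (c : Fin (2 * d - 2) → ℂ) (hcinj : Function.Injective c)
    (hcq : ∀ i, q.eval (c i) ≠ 0)
    (hcderiv : ∀ i, deriv (Rfun p q) (c i) = 0)
    (hcsimple : ∀ i, deriv (deriv (Rfun p q)) (c i) ≠ 0)
    (hcall : ∀ z : ℂ, q.eval z ≠ 0 → deriv (Rfun p q) z = 0 → ∃ i, c i = z)
    (hq0 : q.eval 0 ≠ 0) (hR0 : Rfun p q 0 = 0)
    (hq1 : q.eval 1 ≠ 0) (hR1 : Rfun p q 1 = 1)
    (hc01 : ∀ i, c i ≠ 0 ∧ c i ≠ 1)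
    (hd01 : ∀ i, Rfun p q (c i) ≠ 0 ∧ Rfun p q (c i) ≠ 1)
    (a : ℂ) (ha0 : a ≠ 0) (ha1 : a ≠ 1) (haq : q.eval a ≠ 0)
    (hader : deriv (Rfun p q) a ≠ 0)
    (hRa0 : Rfun p q a ≠ 0) (hRa1 : Rfun p q a ≠ 1) :
    ∀ z : ℂ, ¬ IsCritValue p q z → z ≠ 0 → z ≠ 1 → z ≠ Rfun p q a →
      (∀ i, z ≠ Rfun p q (c i)) →
      (∑' y : {y : ℂ // q.eval y ≠ 0 ∧ Rfun p q y = z},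
          gam a (y : ℂ) / (deriv (Rfun p q) (y : ℂ)) ^ 2) =
        gam (Rfun p q a) z / deriv (Rfun p q) a +
          ∑ i, (1 / deriv (deriv (Rfun p q)) (c i)) * gam a (c i) *
            gam (Rfun p q (c i)) z := by
  intro z hz hz0 hz1 hza hzc
  classical
  set W := derivNum p q with hW
  have hqp : ∀ y, (p - C z * q).eval y = 0 → q.eval y ≠ 0 := by
    intro y hy hq
    obtain ⟨u, v, huv⟩ := hcop
    have := congrArg (eval y) huv
    simp only [eval_sub, eval_mul, eval_C, hq, mul_zero, sub_zero] at hy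
    simp [hy, hq] at this
  have hRp : ∀ y, q.eval y ≠ 0 → p.eval y = Rfun p q y * q.eval y := fun y hy => by
    rw [Rfun, div_mul_cancel₀ _ hy]
  have hPe : ∀ y, q.eval y ≠ 0 → (p - C z * q).eval y = (Rfun p q y - z) * q.eval y := by
    intro y hy
    simp only [eval_sub, eval_mul, eval_C, hRp y hy]
    ring
  have hfib : ∀ y, (p - C z * q).eval y = 0 ↔ q.eval y ≠ 0 ∧ Rfun p q y = z := by
    refine fun y => ⟨fun h => ⟨hqp y h, ?_⟩, fun h => by rw [hPe y h.1, h.2]; ring⟩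
    have h' := hPe y (hqp y h)
    rw [h, eq_comm, mul_eq_zero, sub_eq_zero] at h'
    exact h'.resolve_right (hqp y h)
  have hWa : W.eval a ≠ 0 := fun h => hader ((derivNum_eval_eq_zero_iff p q haq).1 h)
  have hW0 : W ≠ 0 := fun h => hWa (by simp [h])
  have hWc : ∀ i, W.eval (c i) = 0 := fun i =>
    (derivNum_eval_eq_zero_iff p q (hcq i)).2 (hcderiv i)
  have hWle : W.natDegree ≤ 2 * d - 2 :=
    (natDegree_derivNum_le p q (by omega) (by omega)).trans (by omega)
  have hcardc : (Finset.univ.image c).card = 2 * d - 2 := by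
    rw [Finset.card_image_of_injective _ hcinj, Finset.card_univ, Fintype.card_fin]
  have hsub : Finset.univ.image c ⊆ W.roots.toFinset := by
    intro x hx
    obtain ⟨i, -, rfl⟩ := Finset.mem_image.1 hx
    simpa [hW0] using hWc i
  have hroots_le : W.roots.toFinset.card ≤ W.natDegree :=
    (Multiset.toFinset_card_le _).trans (card_roots' W)
  have hWdeg : W.natDegree = 2 * d - 2 :=
    le_antisymm hWle (hcardc ▸ (Finset.card_le_card hsub).trans hroots_le)
  have hWroots : Finset.univ.image c = W.roots.toFinset :=
    Finset.eq_of_subset_of_card_le hsub ((hroots_le.trans hWle).trans_eq hcardc.symm)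
  have hWroot : ∀ x, W.eval x = 0 ↔ ∃ i, c i = x := by
    intro x
    have : x ∈ W.roots.toFinset ↔ x ∈ Finset.univ.image c := by rw [hWroots]
    simpa [hW0] using this
  have hPdeg : (p - C z * q).natDegree = d := by
    rw [natDegree_sub_eq_left_of_natDegree_lt, hdp]
    exact (natDegree_C_mul_le z q).trans_lt (by omega)
  have hP0 : p - C z * q ≠ 0 := by
    intro h
    rw [h, natDegree_zero] at hPdeg
    omega
  obtain ⟨A, hA⟩ : X ∣ p := by
    rw [X_dvd_iff, coeff_zero_eq_eval_zero, hRp 0 hq0, hR0, zero_mul]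
  obtain ⟨B, hB⟩ : X - C 1 ∣ p - q := by
    rw [dvd_iff_isRoot, IsRoot, eval_sub, hRp 1 hq1, hR1, one_mul, sub_self]
  have hAdeg : A.natDegree ≤ d - 1 := by
    rcases eq_or_ne A 0 with rfl | hA0
    · simp
    have := congrArg natDegree hA
    rw [natDegree_X_mul hA0] at this
    omega
  have hBdeg : B.natDegree ≤ d - 1 := by
    rcases eq_or_ne B 0 with rfl | hB0
    · simp
    have := congrArg natDegree hB
    rw [natDegree_mul (X_sub_C_ne_zero 1) hB0, natDegree_X_sub_C] at this
    have := natDegree_sub_le p q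
    rw [hdp, hdq, max_eq_left (by omega)] at this
    omega
  have hABe : ∀ x, q.eval x ≠ 0 → x * (x - 1) * (A.eval x * B.eval x) =
      Rfun p q x * (Rfun p q x - 1) * q.eval x ^ 2 := by
    intro x hx
    have h1 := congrArg (eval x) hA
    have h2 := congrArg (eval x) hB
    simp only [eval_sub, eval_mul, eval_X, eval_C] at h1 h2
    have h3 := hRp x hx
    rw [h3] at h1 h2
    linear_combination (-(x - 1) * B.eval x) * h1 - Rfun p q x * q.eval x * h2
  set P := p - C z * q with hP
  set D := P * W * (X - C a) with hD
  have hDe : ∀ x, D.eval x = P.eval x * W.eval x * (x - a) := fun x => by simp [hD]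
  have hD'e : ∀ x, D.derivative.eval x =
      (P.derivative.eval x * W.eval x + P.eval x * W.derivative.eval x) * (x - a) +
        P.eval x * W.eval x := fun x => by simp [hD]
  have hDdeg : D.natDegree = 3 * d - 1 := by
    rw [hD, natDegree_mul (mul_ne_zero hP0 hW0) (X_sub_C_ne_zero a), natDegree_mul hP0 hW0,
      natDegree_X_sub_C, hPdeg, hWdeg]
    omega
  have hNdeg : (A * B * q).natDegree ≤ 3 * d - 3 := by
    have h1 := natDegree_mul_le (p := A * B) (q := q)
    have h2 := natDegree_mul_le (p := A) (q := B)
    omega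
  have hPa : P.eval a ≠ 0 := fun h => hza ((hfib a).1 h).2.symm
  have hPc : ∀ i, P.eval (c i) ≠ 0 := fun i h => hzc i ((hfib (c i)).1 h).2.symm
  have hca : ∀ i, c i ≠ a := fun i h => hWa (h ▸ hWc i)
  have hWP : ∀ y, P.eval y = 0 → W.eval y ≠ 0 := by
    intro y hy h
    obtain ⟨i, rfl⟩ := (hWroot y).1 h
    exact hPc i hy
  have hyP : ∀ y, P.eval y = 0 → P.derivative.eval y = W.eval y / q.eval y := by
    intro y hy
    have hq := hqp y hy
    have h : p.eval y = z * q.eval y := by rw [hRp y hq, ((hfib y).1 hy).2]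
    rw [eq_div_iff hq, hW, eval_derivNum, h]
    simp only [hP, derivative_sub, derivative_C_mul, eval_sub, eval_C_mul]
    ring
  have hW'c : ∀ i, W.derivative.eval (c i) =
      deriv (deriv (Rfun p q)) (c i) * q.eval (c i) ^ 2 := by
    intro i
    rw [deriv_deriv_Rfun p q (hcq i) (hcderiv i), div_mul_cancel₀ _ (pow_ne_zero 2 (hcq i))]
  have hPne : ∀ y, P.eval y = 0 → y ≠ a := fun y hy h => hPa (h ▸ hy)
  have hsimple : ∀ r, D.eval r = 0 → D.derivative.eval r ≠ 0 := by
    intro r hr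
    rw [hDe, mul_eq_zero, mul_eq_zero, sub_eq_zero] at hr
    rw [hD'e]
    rcases hr with (h | h) | rfl
    · rw [h, hyP r h, zero_mul, zero_mul, add_zero, add_zero]
      exact mul_ne_zero (mul_ne_zero (div_ne_zero (hWP r h) (hqp r h)) (hWP r h))
        (sub_ne_zero.2 (hPne r h))
    · obtain ⟨i, rfl⟩ := (hWroot r).1 h
      rw [h, mul_zero, mul_zero, zero_add, add_zero, hW'c]
      exact mul_ne_zero (mul_ne_zero (hPc i) (mul_ne_zero (hcsimple i) (pow_ne_zero 2 (hcq i))))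
        (sub_ne_zero.2 (hca i))
    · rw [sub_self, mul_zero, zero_add]
      exact mul_ne_zero hPa hWa
  have hres := sum_eval_div_derivative_eq_zero (N := A * B * q) (D := D) (by omega) hsimple
  have hDroots : D.roots.toFinset = P.roots.toFinset ∪ (Finset.univ.image c ∪ {a}) := by
    rw [hD, roots_mul (mul_ne_zero (mul_ne_zero hP0 hW0) (X_sub_C_ne_zero a)),
      roots_mul (mul_ne_zero hP0 hW0), roots_X_sub_C, hWroots]
    ext x
    simp
  have hdisj : Disjoint P.roots.toFinset (Finset.univ.image c ∪ {a}) := by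
    rw [Finset.disjoint_left]
    intro x hx hx'
    have hx0 : P.eval x = 0 := by simpa [hP0] using hx
    rcases Finset.mem_union.1 hx' with h | h
    · obtain ⟨i, -, rfl⟩ := Finset.mem_image.1 h
      exact hPc i hx0
    · exact hPne x hx0 (Finset.mem_singleton.1 h)
  have hdisj' : Disjoint (Finset.univ.image c) {a} := by
    simpa using hca
  rw [hDroots, Finset.sum_union hdisj, Finset.sum_union hdisj', Finset.sum_singleton,
    Finset.sum_image hcinj.injOn] at hres
  have hset : {y : ℂ | q.eval y ≠ 0 ∧ Rfun p q y = z} = ↑P.roots.toFinset := by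
    ext y
    simp [hP0, ← hfib]
  have htsum : (∑' y : {y : ℂ // q.eval y ≠ 0 ∧ Rfun p q y = z},
      gam a (y : ℂ) / (deriv (Rfun p q) (y : ℂ)) ^ 2) =
        ∑ y ∈ P.roots.toFinset, gam a y / deriv (Rfun p q) y ^ 2 := by
    have := Finset.tsum_subtype' P.roots.toFinset
      (fun y => gam a y / deriv (Rfun p q) y ^ 2)
    rw [← hset] at this
    exact this
  have hABdiv : ∀ x, q.eval x ≠ 0 → x ≠ 0 → x ≠ 1 → A.eval x * B.eval x =
      Rfun p q x * (Rfun p q x - 1) * q.eval x ^ 2 / (x * (x - 1)) := by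
    intro x hq h0 h1
    rw [← hABe x hq, mul_div_cancel_left₀ _ (mul_ne_zero h0 (sub_ne_zero.2 h1))]
  have hz1' := sub_ne_zero.2 hz1
  have ha1' := sub_ne_zero.2 ha1
  have hfiber_term : ∀ y ∈ P.roots.toFinset, gam a y / deriv (Rfun p q) y ^ 2 =
      a * (a - 1) / (z * (z - 1)) * ((A * B * q).eval y / D.derivative.eval y) := by
    intro y hy
    have hy0 : P.eval y = 0 := by simpa [hP0] using hy
    obtain ⟨hq, hRy⟩ := (hfib y).1 hy0
    have h0 : y ≠ 0 := by
      rintro rfl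
      exact hz0 (hRy.symm.trans hR0)
    have h1 : y ≠ 1 := by
      rintro rfl
      exact hz1 (hRy.symm.trans hR1)
    have h1' := sub_ne_zero.2 h1
    have hya := sub_ne_zero.2 (hPne y hy0)
    have hWy := hWP y hy0
    rw [hD'e, hy0, hyP y hy0, eval_mul, eval_mul, hABdiv y hq h0 h1, hRy, deriv_Rfun p q hq,
      ← hW, gam]
    field_simp
    ring
  have hcrit_term : ∀ i, (1 / deriv (deriv (Rfun p q)) (c i)) * gam a (c i) *
      gam (Rfun p q (c i)) z = -(a * (a - 1) / (z * (z - 1)) *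
        ((A * B * q).eval (c i) / D.derivative.eval (c i))) := by
    intro i
    have hq := hcq i
    have h0 := (hc01 i).1
    have h1' := sub_ne_zero.2 (hc01 i).2
    have hcs := hcsimple i
    have hcia := sub_ne_zero.2 (hca i)
    have hzR := sub_ne_zero.2 (hzc i)
    have hRz := sub_ne_zero.2 (hzc i).symm
    rw [hD'e, hWc, hW'c, hPe _ hq, eval_mul, eval_mul, hABdiv _ hq h0 (hc01 i).2, gam, gam,
      ← neg_sub (Rfun p q (c i)) z]
    field_simp
    ring
  have ha_term : gam (Rfun p q a) z / deriv (Rfun p q) a = -(a * (a - 1) / (z * (z - 1)) *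
      ((A * B * q).eval a / D.derivative.eval a)) := by
    have hRz := sub_ne_zero.2 hza.symm
    rw [hD'e, hPe _ haq, eval_mul, eval_mul, hABdiv _ haq ha0 ha1, deriv_Rfun p q haq, ← hW, gam,
      ← neg_sub (Rfun p q a) z]
    field_simp
    ring
  rw [htsum, Finset.sum_congr rfl hfiber_term, ha_term,
    Finset.sum_congr rfl fun i _ => hcrit_term i, Finset.sum_neg_distrib, ← Finset.mul_sum,
    ← Finset.mul_sum]
  linear_combination (a * (a - 1) / (z * (z - 1))) * hres

end
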